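/- arXiv:1411.3468 — 2 statements merged into one kernel-verified Lean document; each statement's English description precedes it below -/
import Mathlib

section
/- The only rational points on the curve z² = (1 − s²)(1 − 9s²) are the trivial ones: if s, z ∈ ℚ satisfy z² = (1 − s²)(1 − 9s²), then s ∈ {0, 1, −1, 1/3, −1/3} (equivalently, either s = 0 and z = ±1, or s ∈ {±1, ±1/3} and z = 0). -/
namespace Q24

lemma cop_of (A B : ℤ) (h : ∀ p : ℤ, Prime p → p ∣ A → p ∣ B → False) : IsCoprime A B := by
  rw [Int.isCoprime_iff_gcd_eq_one]
  by_contra hne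
  obtain ⟨p, hp, hd⟩ := Nat.exists_prime_and_dvd hne
  have hd' : (p : ℤ) ∣ (Int.gcd A B : ℤ) := by exact_mod_cast hd
  exact h p (Nat.prime_iff_prime_int.mp hp) (hd'.trans (Int.gcd_dvd_left ..))
    (hd'.trans (Int.gcd_dvd_right ..))

lemma cop_no {A B p : ℤ} (h : IsCoprime A B) (hp : Prime p) (ha : p ∣ A) (hb : p ∣ B) : False :=
  hp.not_isUnit (h.isUnit_of_dvd' ha hb)

lemma sq_split (A B k : ℤ) (hc : IsCoprime A B) (h : A * B = k ^ 2) :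
    ∃ c d : ℤ, IsCoprime c d ∧ ((A = c ^ 2 ∧ B = d ^ 2) ∨ (A = -c ^ 2 ∧ B = -d ^ 2)) := by
  obtain ⟨c, hA⟩ := Int.sq_of_isCoprime hc h
  obtain ⟨d, hB⟩ := Int.sq_of_isCoprime hc.symm (by rw [mul_comm]; exact h)
  have key : IsCoprime (c ^ 2) (d ^ 2) := by
    rcases hA with hA | hA <;> rcases hB with hB | hB <;> rw [hA, hB] at hc <;>
      simpa only [IsCoprime.neg_left_iff, IsCoprime.neg_right_iff] using hc
  refine ⟨c, d, (IsCoprime.pow_iff (by norm_num) (by norm_num)).mp key, ?_⟩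
  rcases hA with hA | hA <;> rcases hB with hB | hB
  · left; exact ⟨hA, hB⟩
  · have h0 : (c * d) ^ 2 = 0 := by
      have : (c * d) ^ 2 = - k ^ 2 := by rw [← h, hA, hB]; ring
      nlinarith [sq_nonneg (c * d), sq_nonneg k]
    rcases mul_eq_zero.mp (pow_eq_zero_iff (by norm_num) |>.mp h0) with h1 | h1
    · right; subst h1; exact ⟨by simpa using hA, hB⟩
    · left; subst h1; exact ⟨hA, by simpa using hB⟩
  · have h0 : (c * d) ^ 2 = 0 := by
      have : (c * d) ^ 2 = - k ^ 2 := by rw [← h, hA, hB]; ring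
      nlinarith [sq_nonneg (c * d), sq_nonneg k]
    rcases mul_eq_zero.mp (pow_eq_zero_iff (by norm_num) |>.mp h0) with h1 | h1
    · left; subst h1; exact ⟨by simpa using hA, hB⟩
    · right; subst h1; exact ⟨hA, by simpa using hB⟩
  · right; exact ⟨hA, hB⟩

lemma three_sq (x y : ℤ) (h : (3 : ℤ) ∣ x ^ 2 + y ^ 2) : (3 : ℤ) ∣ x ∧ (3 : ℤ) ∣ y := by
  have h1 : x % 3 = 0 ∨ x % 3 = 1 ∨ x % 3 = 2 := by omega
  have h2 : y % 3 = 0 ∨ y % 3 = 1 ∨ y % 3 = 2 := by omega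
  have h3 := Int.emod_eq_zero_of_dvd h
  rcases h1 with h1 | h1 | h1 <;> rcases h2 with h2 | h2 | h2 <;>
    simp [pow_two, Int.add_emod, Int.mul_emod, h1, h2] at h3 <;> omega

lemma sq4 (x : ℤ) : (x % 2 = 0 ∧ x ^ 2 % 4 = 0) ∨ (x % 2 = 1 ∧ x ^ 2 % 8 = 1) := by
  rcases Int.even_or_odd x with h | h
  · left
    obtain ⟨m, rfl⟩ := h
    refine ⟨by omega, ?_⟩
    have : (m + m) ^ 2 = 4 * m ^ 2 := by ring
    omega
  · right
    exact ⟨Int.odd_iff.mp h, Int.sq_mod_four_eq_one_of_odd h |> fun _ => by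
      obtain ⟨m, rfl⟩ := h
      obtain ⟨k, hk⟩ := Int.even_mul_succ_self m
      have : (2 * m + 1) ^ 2 = 4 * (m * (m + 1)) + 1 := by ring
      omega⟩

/-- `P` even, `Q` odd, product `8 a^2`. -/
lemma split8 (P Q a : ℤ) (hc : IsCoprime P Q) (hP : P % 2 = 0) (h : P * Q = 8 * a ^ 2) :
    ∃ x y : ℤ, IsCoprime x y ∧ x % 2 = 1 ∧ (P + Q) ^ 2 = (x ^ 2 + 8 * y ^ 2) ^ 2 ∧
      a ^ 2 = x ^ 2 * y ^ 2 := by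
  have h2Q : IsCoprime (2 : ℤ) Q := hc.of_isCoprime_of_dvd_left (Int.dvd_of_emod_eq_zero hP)
  have h8Q : IsCoprime (8 : ℤ) Q := by
    have := h2Q.pow_left (m := 3); norm_num at this; exact this
  have h8 : (8 : ℤ) ∣ P := h8Q.dvd_of_dvd_mul_right ⟨_, h⟩
  obtain ⟨P', rfl⟩ := h8
  have hc' : IsCoprime P' Q := hc.of_isCoprime_of_dvd_left ⟨8, by ring⟩
  obtain ⟨y, x, hyx, hs⟩ := sq_split P' Q a hc' (by linarith)
  have hQ : Q % 2 = 1 := by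
    by_contra hq
    exact cop_no h2Q Int.prime_two (dvd_refl _) (by omega)
  refine ⟨x, y, hyx.symm, ?_, ?_, ?_⟩
  · rcases sq4 x with hx | hx
    · rcases hs with ⟨_, hs⟩ | ⟨_, hs⟩ <;> omega
    · exact hx.1
  · rcases hs with ⟨h1, h2⟩ | ⟨h1, h2⟩ <;> rw [h1, h2] <;> ring
  · have : a ^ 2 = P' * Q := by linarith
    rcases hs with ⟨h1, h2⟩ | ⟨h1, h2⟩ <;> rw [this, h1, h2] <;> ring

/-- `P` even, `Q` odd, product `12 a^2`. -/
lemma split12 (P Q a : ℤ) (hc : IsCoprime P Q) (hP : P % 2 = 0) (h : P * Q = 12 * a ^ 2) :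
    ∃ e f : ℤ, IsCoprime e f ∧ e % 2 = 1 ∧ a ^ 2 = e ^ 2 * f ^ 2 ∧
      ((P - Q) ^ 2 = (e ^ 2 - 12 * f ^ 2) ^ 2 ∨ (P - Q) ^ 2 = (3 * e ^ 2 - 4 * f ^ 2) ^ 2) := by
  have h2Q : IsCoprime (2 : ℤ) Q := hc.of_isCoprime_of_dvd_left (Int.dvd_of_emod_eq_zero hP)
  have h4Q : IsCoprime (4 : ℤ) Q := by
    have := h2Q.pow_left (m := 2); norm_num at this; exact this
  have h4 : (4 : ℤ) ∣ P := h4Q.dvd_of_dvd_mul_right ⟨3 * a ^ 2, by rw [h]; ring⟩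
  have hQ : Q % 2 = 1 := by
    by_contra hq
    exact cop_no h2Q Int.prime_two (dvd_refl _) (by omega)
  obtain ⟨P', rfl⟩ := h4
  have hc' : IsCoprime P' Q := hc.of_isCoprime_of_dvd_left ⟨4, by ring⟩
  have h3 : P' * Q = 3 * a ^ 2 := by linarith
  rcases Int.prime_three.dvd_or_dvd (Dvd.intro _ h3.symm) with ⟨R, rfl⟩ | ⟨R, rfl⟩
  · obtain ⟨f, e, hfe, hs⟩ := sq_split R Q a (hc'.of_isCoprime_of_dvd_left ⟨3, by ring⟩)
      (by linarith)
    refine ⟨e, f, hfe.symm, ?_, ?_, Or.inl ?_⟩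
    · rcases sq4 e with hx | hx
      · rcases hs with ⟨_, hs⟩ | ⟨_, hs⟩ <;> omega
      · exact hx.1
    · have : a ^ 2 = R * Q := by linarith
      rcases hs with ⟨h1, h2⟩ | ⟨h1, h2⟩ <;> rw [this, h1, h2] <;> ring
    · rcases hs with ⟨h1, h2⟩ | ⟨h1, h2⟩ <;> rw [h1, h2] <;> ring
  · obtain ⟨f, e, hfe, hs⟩ := sq_split P' R a (hc'.of_isCoprime_of_dvd_right ⟨3, by ring⟩)
      (by linarith)
    refine ⟨e, f, hfe.symm, ?_, ?_, Or.inr ?_⟩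
    · rcases sq4 e with hx | hx
      · rcases hs with ⟨_, hs⟩ | ⟨_, hs⟩ <;> omega
      · exact hx.1
    · have : a ^ 2 = P' * R := by linarith
      rcases hs with ⟨h1, h2⟩ | ⟨h1, h2⟩ <;> rw [this, h1, h2] <;> ring
    · rcases hs with ⟨h1, h2⟩ | ⟨h1, h2⟩ <;> rw [h1, h2] <;> ring

/-- Halves of the sum and the difference of two coprime odd numbers. -/
lemma halves (u v : ℤ) (hc : IsCoprime u v) (hu : u % 2 = 1) (hv : v % 2 = 1) :
    ∃ P Q : ℤ, IsCoprime P Q ∧ P % 2 = 0 ∧ u ^ 2 = (P + Q) ^ 2 ∧ v ^ 2 = (P - Q) ^ 2 := by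
  obtain ⟨P, hP⟩ : (2 : ℤ) ∣ u + v := by omega
  obtain ⟨Q, hQ⟩ : (2 : ℤ) ∣ u - v := by omega
  have h1 : u = P + Q := by omega
  have h2 : v = P - Q := by omega
  have hPQ : IsCoprime P Q := by
    apply cop_of
    intro p hp h3 h4
    exact cop_no hc hp (h1 ▸ dvd_add h3 h4) (h2 ▸ dvd_sub h3 h4)
  by_cases h : P % 2 = 0
  · exact ⟨P, Q, hPQ, h, by rw [h1], by rw [h2]⟩
  · exact ⟨Q, P, hPQ.symm, by omega, by rw [h1]; ring, by rw [h2]; ring⟩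

set_option maxHeartbeats 2000000 in
lemma step (a b u v : ℤ) (hc : IsCoprime a b) (ha : a ≠ 0) (h1 : b ^ 2 - a ^ 2 = u ^ 2)
    (h2 : b ^ 2 - 9 * a ^ 2 = v ^ 2) :
    ∃ a' b' u' v' : ℤ, IsCoprime a' b' ∧ a' ≠ 0 ∧ b' ^ 2 - a' ^ 2 = u' ^ 2 ∧
      b' ^ 2 - 9 * a' ^ 2 = v' ^ 2 ∧ a' ^ 2 < a ^ 2 := by
  have hnot : ¬ (a % 2 = 0 ∧ b % 2 = 0) := fun ⟨x, y⟩ =>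
    cop_no hc Int.prime_two (by omega) (by omega)
  have hb3 : ¬ (3 : ℤ) ∣ b := by
    intro h
    have h3 : (3 : ℤ) ∣ a ^ 2 + u ^ 2 := by
      have : a ^ 2 + u ^ 2 = b ^ 2 := by linarith
      rw [this]; exact dvd_pow h (by norm_num)
    exact cop_no hc Int.prime_three (three_sq _ _ h3).1 h
  have ha2 : a % 2 = 0 := by
    by_contra hodd
    have hu4 : u % 2 = 0 ∧ v % 2 = 0 ∧ b % 2 = 1 := by
      rcases sq4 a with x | x <;> rcases sq4 b with y | y <;> rcases sq4 u with z | z <;>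
        rcases sq4 v with w | w <;> omega
    obtain ⟨hu, hv, hb⟩ := hu4
    obtain ⟨u1, rfl⟩ : (2 : ℤ) ∣ u := by omega
    obtain ⟨v1, rfl⟩ : (2 : ℤ) ∣ v := by omega
    have e : u1 ^ 2 - v1 ^ 2 = 2 * a ^ 2 := by nlinarith
    rcases sq4 a with x | x <;> rcases sq4 u1 with z | z <;>
        rcases sq4 v1 with w | w <;> omega
  have hb2 : b % 2 = 1 := by omega
  have huv2 : u % 2 = 1 ∧ v % 2 = 1 := by
    rcases sq4 a with x | x <;> rcases sq4 b with y | y <;> rcases sq4 u with z | z <;>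
        rcases sq4 v with w | w <;> omega
  obtain ⟨a1, rfl⟩ : (2 : ℤ) ∣ a := by omega
  have huv : IsCoprime u v := by
    apply cop_of
    intro p hp hu hv
    have hp8 : ¬ p ∣ 8 := by
      intro h
      have h' : p ∣ 2 ^ 3 := by norm_num; exact h
      have : p ∣ 2 := hp.dvd_of_dvd_pow h'
      have h3 : Associated p 2 := hp.associated_of_dvd Int.prime_two this
      have : (2 : ℤ) ∣ u := h3.symm.dvd.trans hu
      omega
    have hA : p ∣ 8 * (2 * a1) ^ 2 := by
      have : 8 * (2 * a1) ^ 2 = u ^ 2 - v ^ 2 := by linarith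
      rw [this]; exact dvd_sub (dvd_pow hu (by norm_num)) (dvd_pow hv (by norm_num))
    have hA' : p ∣ 2 * a1 := hp.dvd_of_dvd_pow ((hp.dvd_or_dvd hA).resolve_left hp8)
    have hB : p ∣ b ^ 2 := by
      have : b ^ 2 = u ^ 2 + (2 * a1) ^ 2 := by linarith
      rw [this]; exact dvd_add (dvd_pow hu (by norm_num)) (dvd_pow hA' (by norm_num))
    exact cop_no hc hp hA' (hp.dvd_of_dvd_pow hB)
  obtain ⟨P, Q, hPQ, hP, e1, e2⟩ := halves u v huv huv2.1 huv2.2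
  obtain ⟨x, y, hxy, hx, e3, e4⟩ := split8 P Q a1 hPQ hP (by nlinarith)
  have e5 : (x ^ 2 + 4 * y ^ 2) * (x ^ 2 + 16 * y ^ 2) = b ^ 2 := by
    have : b ^ 2 = (x ^ 2 + 8 * y ^ 2) ^ 2 + 4 * (x ^ 2 * y ^ 2) := by
      rw [← e3, ← e4, ← e1]; linarith
    rw [this]; ring
  have aux : ∀ p : ℤ, Prime p → p ∣ 12 → ¬ p ∣ 2 → p ∣ 3 := by
    intro p hp h h2
    have h' : p ∣ 2 * (2 * 3) := by norm_num; exact h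
    exact (hp.dvd_or_dvd ((hp.dvd_or_dvd h').resolve_left h2)).resolve_left h2
  have hx2 : x ^ 2 % 8 = 1 := by rcases sq4 x with h | h <;> omega
  have hcop : IsCoprime (x ^ 2 + 4 * y ^ 2) (x ^ 2 + 16 * y ^ 2) := by
    apply cop_of
    intro p hp hA hB
    have hp2 : ¬ p ∣ 2 := by
      intro h
      have h3 := (hp.associated_of_dvd Int.prime_two h).symm.dvd.trans hA
      omega
    have hp12 : ¬ p ∣ 12 := by
      intro h
      have h3 := hp.associated_of_dvd Int.prime_three (aux p hp h hp2)
      have h4 : p ∣ b ^ 2 := e5 ▸ Dvd.dvd.mul_right hA _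
      exact hb3 (h3.symm.dvd.trans (hp.dvd_of_dvd_pow h4))
    have hy : p ∣ 12 * y ^ 2 := by
      have : 12 * y ^ 2 = (x ^ 2 + 16 * y ^ 2) - (x ^ 2 + 4 * y ^ 2) := by ring
      rw [this]; exact dvd_sub hB hA
    have hxx : p ∣ 12 * x ^ 2 := by
      have : 12 * x ^ 2 = 16 * (x ^ 2 + 4 * y ^ 2) - 4 * (x ^ 2 + 16 * y ^ 2) := by ring
      rw [this]; exact dvd_sub (Dvd.dvd.mul_left hA _) (Dvd.dvd.mul_left hB _)
    exact cop_no hxy hp (hp.dvd_of_dvd_pow ((hp.dvd_or_dvd hxx).resolve_left hp12))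
      (hp.dvd_of_dvd_pow ((hp.dvd_or_dvd hy).resolve_left hp12))
  obtain ⟨r, t, hrt, hs⟩ := sq_split _ _ b hcop e5
  have hy0 : y ≠ 0 := by
    rintro rfl
    have : a1 ^ 2 = 0 := by rw [e4]; ring
    exact ha (by simp [pow_eq_zero_iff (two_ne_zero) |>.mp this])
  have hxpos : 0 < x ^ 2 := by
    have : x ≠ 0 := by omega
    positivity
  obtain ⟨er, et⟩ : x ^ 2 + 4 * y ^ 2 = r ^ 2 ∧ x ^ 2 + 16 * y ^ 2 = t ^ 2 := by
    rcases hs with hs | hs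
    · exact hs
    · nlinarith [sq_nonneg r, sq_nonneg y]
  have hpar : r % 2 = 1 ∧ t % 2 = 1 ∧ y % 2 = 0 := by
    rcases sq4 r with h | h <;> rcases sq4 t with h' | h' <;> rcases sq4 y with h'' | h'' <;> omega
  obtain ⟨hr, ht, hy⟩ := hpar
  obtain ⟨y1, rfl⟩ : (2 : ℤ) ∣ y := by omega
  obtain ⟨P, Q, hPQ, hP, e6, e7⟩ := halves t r hrt.symm ht hr
  obtain ⟨e, f, hef, he, e8, e9⟩ := split12 P Q y1 hPQ hP (by nlinarith)
  have he2 : e ^ 2 % 8 = 1 := by rcases sq4 e with h | h <;> omega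
  have hy10 : y1 ≠ 0 := by rintro rfl; simp at hy0
  have hf0 : f ≠ 0 := by
    rintro rfl
    have : y1 ^ 2 = 0 := by rw [e8]; ring
    exact hy10 (pow_eq_zero_iff (two_ne_zero) |>.mp this)
  have hfpos : 0 < f ^ 2 := by positivity
  have hepos : 0 < e ^ 2 := by
    have : e ≠ 0 := by omega
    positivity
  have hsize : (2 * f) ^ 2 < (2 * a1) ^ 2 := by
    have : (2 * a1) ^ 2 = 16 * (x ^ 2 * (e ^ 2 * f ^ 2)) := by rw [← e8]; linarith
    have g1 : f ^ 2 ≤ e ^ 2 * f ^ 2 := le_mul_of_one_le_left hfpos.le hepos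
    have g2 : e ^ 2 * f ^ 2 ≤ x ^ 2 * (e ^ 2 * f ^ 2) :=
      le_mul_of_one_le_left (by positivity) hxpos
    have g3 : (2 * f) ^ 2 = 4 * f ^ 2 := by ring
    linarith
  have h2e : IsCoprime (2 : ℤ) e := by
    apply cop_of
    intro p hp h h'
    have h3 := (hp.associated_of_dvd Int.prime_two h).symm.dvd.trans h'
    omega
  have h2fe : IsCoprime (2 * f) e := h2e.mul_left hef.symm
  rcases e9 with e9 | e9
  · have e10 : (e ^ 2 - 4 * f ^ 2) * (e ^ 2 - 36 * f ^ 2) = x ^ 2 := by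
      have : x ^ 2 = (e ^ 2 - 12 * f ^ 2) ^ 2 - 16 * (e ^ 2 * f ^ 2) := by
        rw [← e9, ← e7, ← e8]; linarith
      rw [this]; ring
    have hcop : IsCoprime (e ^ 2 - 4 * f ^ 2) (e ^ 2 - 36 * f ^ 2) := by
      apply cop_of
      intro p hp hA hB
      have hp2 : ¬ p ∣ 2 := by
        intro h
        have h3 := (hp.associated_of_dvd Int.prime_two h).symm.dvd.trans hA
        omega
      have hp8 : ¬ p ∣ 2 ^ 3 := fun h => hp2 (hp.dvd_of_dvd_pow h)
      have hy : p ∣ 2 ^ 3 * (2 * f) ^ 2 := by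
        have : 2 ^ 3 * (2 * f) ^ 2 = (e ^ 2 - 4 * f ^ 2) - (e ^ 2 - 36 * f ^ 2) := by ring
        rw [this]; exact dvd_sub hA hB
      have hxx : p ∣ 2 ^ 3 * e ^ 2 := by
        have : 2 ^ 3 * e ^ 2 = 9 * (e ^ 2 - 4 * f ^ 2) - (e ^ 2 - 36 * f ^ 2) := by ring
        rw [this]; exact dvd_sub (Dvd.dvd.mul_left hA _) hB
      exact cop_no h2fe hp (hp.dvd_of_dvd_pow ((hp.dvd_or_dvd hy).resolve_left hp8))
        (hp.dvd_of_dvd_pow ((hp.dvd_or_dvd hxx).resolve_left hp8))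
    obtain ⟨c, d, -, hs⟩ := sq_split _ _ x hcop e10
    rcases hs with ⟨g1, g2⟩ | ⟨g1, g2⟩
    · exact ⟨2 * f, e, c, d, h2fe, by omega, by rw [← g1]; ring, by rw [← g2]; ring, hsize⟩
    · exfalso
      rcases sq4 c with h | h <;> omega
  · have e10 : (e ^ 2 - 4 * f ^ 2) * (9 * e ^ 2 - 4 * f ^ 2) = x ^ 2 := by
      have : x ^ 2 = (3 * e ^ 2 - 4 * f ^ 2) ^ 2 - 16 * (e ^ 2 * f ^ 2) := by
        rw [← e9, ← e7, ← e8]; linarith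
      rw [this]; ring
    have hcop : IsCoprime (e ^ 2 - 4 * f ^ 2) (9 * e ^ 2 - 4 * f ^ 2) := by
      apply cop_of
      intro p hp hA hB
      have hp2 : ¬ p ∣ 2 := by
        intro h
        have h3 := (hp.associated_of_dvd Int.prime_two h).symm.dvd.trans hA
        omega
      have hp8 : ¬ p ∣ 2 ^ 3 := fun h => hp2 (hp.dvd_of_dvd_pow h)
      have hy : p ∣ 2 ^ 3 * (2 * f) ^ 2 := by
        have : 2 ^ 3 * (2 * f) ^ 2 = (9 * e ^ 2 - 4 * f ^ 2) - 9 * (e ^ 2 - 4 * f ^ 2) := by ring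
        rw [this]; exact dvd_sub hB (Dvd.dvd.mul_left hA _)
      have hxx : p ∣ 2 ^ 3 * e ^ 2 := by
        have : 2 ^ 3 * e ^ 2 = (9 * e ^ 2 - 4 * f ^ 2) - (e ^ 2 - 4 * f ^ 2) := by ring
        rw [this]; exact dvd_sub hB hA
      exact cop_no h2fe hp (hp.dvd_of_dvd_pow ((hp.dvd_or_dvd hy).resolve_left hp8))
        (hp.dvd_of_dvd_pow ((hp.dvd_or_dvd hxx).resolve_left hp8))
    obtain ⟨c, d, -, hs⟩ := sq_split _ _ x hcop e10
    rcases hs with ⟨g1, g2⟩ | ⟨g1, g2⟩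
    · have h3 : (3 : ℤ) ∣ d ^ 2 + (2 * f) ^ 2 := ⟨3 * e ^ 2, by rw [← g2]; ring⟩
      obtain ⟨⟨d1, rfl⟩, h3f⟩ := three_sq _ _ h3
      obtain ⟨f1, rfl⟩ : (3 : ℤ) ∣ f := by omega
      refine ⟨2 * f1, e, d1, c, h2fe.of_isCoprime_of_dvd_left ⟨3, by ring⟩, by omega,
        by nlinarith, by rw [← g1]; ring, ?_⟩
      nlinarith [sq_nonneg f1]
    · exfalso
      rcases sq4 c with h | h <;> omega

lemma key : ∀ (n : ℕ) (a b u v : ℤ), a ^ 2 < n → IsCoprime a b → a ≠ 0 →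
    b ^ 2 - a ^ 2 = u ^ 2 → b ^ 2 - 9 * a ^ 2 = v ^ 2 → False := by
  intro n
  induction n with
  | zero => intro a b u v h; push_cast at h; nlinarith [sq_nonneg a]
  | succ n ih =>
    intro a b u v h hc ha h1 h2
    obtain ⟨a', b', u', v', hc', ha', h1', h2', hlt⟩ := step a b u v hc ha h1 h2
    exact ih a' b' u' v' (by push_cast at h; linarith) hc' ha' h1' h2'

lemma key1 (a b u v : ℤ) (hc : IsCoprime a b) (ha : a ≠ 0) (h1 : b ^ 2 - a ^ 2 = u ^ 2)
    (h2 : b ^ 2 - 9 * a ^ 2 = v ^ 2) : False := by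
  refine key ((a ^ 2).toNat + 1) a b u v ?_ hc ha h1 h2
  have := Int.self_le_toNat (a ^ 2)
  push_cast
  omega

lemma key2 (a b u v : ℤ) (hc : IsCoprime a b) (hb : b ≠ 0) (h1 : a ^ 2 - b ^ 2 = u ^ 2)
    (h2 : 9 * a ^ 2 - b ^ 2 = v ^ 2) : False := by
  have h3 : (3 : ℤ) ∣ v ^ 2 + b ^ 2 := ⟨3 * a ^ 2, by rw [← h2]; ring⟩
  obtain ⟨⟨v1, rfl⟩, ⟨b1, rfl⟩⟩ := three_sq _ _ h3
  exact key1 b1 a v1 u (hc.symm.of_isCoprime_of_dvd_left ⟨3, by ring⟩) (by omega)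
    (by nlinarith) (by rw [← h1]; ring)

lemma main (p q w : ℤ) (hc : IsCoprime p q) (hp : p ≠ 0) (hq : q ≠ 0)
    (hA0 : q ^ 2 - p ^ 2 ≠ 0) (hB0 : q ^ 2 - 9 * p ^ 2 ≠ 0)
    (h : (q ^ 2 - p ^ 2) * (q ^ 2 - 9 * p ^ 2) = w ^ 2) : False := by
  have hnot : ¬ (p % 2 = 0 ∧ q % 2 = 0) := fun ⟨x, y⟩ =>
    cop_no hc Int.prime_two (by omega) (by omega)
  by_cases hodd : p % 2 = 1 ∧ q % 2 = 1
  · have hp8 : p ^ 2 % 8 = 1 := by rcases sq4 p with h | h <;> omega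
    have hq8 : q ^ 2 % 8 = 1 := by rcases sq4 q with h | h <;> omega
    obtain ⟨A, hA⟩ : (8 : ℤ) ∣ q ^ 2 - p ^ 2 := by omega
    obtain ⟨B, hB⟩ : (8 : ℤ) ∣ q ^ 2 - 9 * p ^ 2 := by omega
    have hpA : p ^ 2 = A - B := by omega
    have hqA : q ^ 2 = 9 * A - B := by omega
    have hcop : IsCoprime A B := by
      apply cop_of
      intro l hl h1 h2
      exact cop_no hc hl (hl.dvd_of_dvd_pow (n := 2) (hpA ▸ dvd_sub h1 h2))
        (hl.dvd_of_dvd_pow (n := 2) (hqA ▸ dvd_sub (Dvd.dvd.mul_left h1 _) h2))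
    rw [hA, hB] at h
    obtain ⟨w1, rfl⟩ : (8 : ℤ) ∣ w := by
      rw [← Int.pow_dvd_pow_iff (n := 2) (by norm_num), ← h]
      exact ⟨A * B, by ring⟩
    obtain ⟨c, d, hcd, hs⟩ := sq_split A B w1 hcop (by nlinarith)
    have hc0 : c ≠ 0 := by
      rintro rfl
      rcases hs with ⟨h1, _⟩ | ⟨h1, _⟩ <;> apply hA0 <;> rw [hA, h1] <;> ring
    have hd0 : d ≠ 0 := by
      rintro rfl
      rcases hs with ⟨_, h1⟩ | ⟨_, h1⟩ <;> apply hB0 <;> rw [hB, h1] <;> ring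
    rcases hs with ⟨h1, h2⟩ | ⟨h1, h2⟩
    · exact key2 c d p q hcd hd0 (by rw [hpA, h1, h2]) (by rw [hqA, h1, h2])
    · exact key1 c d p q hcd hc0 (by rw [hpA, h1, h2]; ring) (by rw [hqA, h1, h2]; ring)
  · have hAodd : (q ^ 2 - p ^ 2) % 2 = 1 := by
      rcases sq4 p with h | h <;> rcases sq4 q with h' | h' <;> omega
    have hcop : IsCoprime (q ^ 2 - p ^ 2) (q ^ 2 - 9 * p ^ 2) := by
      apply cop_of
      intro l hl hA hB
      have hp2 : ¬ l ∣ 2 := by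
        intro h
        have h3 := (hl.associated_of_dvd Int.prime_two h).symm.dvd.trans hA
        omega
      have hp8 : ¬ l ∣ 2 ^ 3 := fun h => hp2 (hl.dvd_of_dvd_pow h)
      have hy : l ∣ 2 ^ 3 * p ^ 2 := by
        have : 2 ^ 3 * p ^ 2 = (q ^ 2 - p ^ 2) - (q ^ 2 - 9 * p ^ 2) := by ring
        rw [this]; exact dvd_sub hA hB
      have hxx : l ∣ 2 ^ 3 * q ^ 2 := by
        have : 2 ^ 3 * q ^ 2 = 9 * (q ^ 2 - p ^ 2) - (q ^ 2 - 9 * p ^ 2) := by ring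
        rw [this]; exact dvd_sub (Dvd.dvd.mul_left hA _) hB
      exact cop_no hc hl (hl.dvd_of_dvd_pow ((hl.dvd_or_dvd hy).resolve_left hp8))
        (hl.dvd_of_dvd_pow ((hl.dvd_or_dvd hxx).resolve_left hp8))
    obtain ⟨c, d, hcd, ⟨h1, h2⟩ | ⟨h1, h2⟩⟩ := sq_split _ _ w hcop h
    · exact key1 p q c d hc hp h1 h2
    · exact key2 p q c d hc hq (by linarith) (by linarith)

end Q24

/-- The only rational points on `z² = (1 - s²)(1 - 9s²)` are the trivial ones:
`s ∈ {0, 1, -1, 1/3, -1/3}`. -/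
theorem rational_points_quartic_24a1 (s z : ℚ)
    (h : z ^ 2 = (1 - s ^ 2) * (1 - 9 * s ^ 2)) :
    s = 0 ∨ s = 1 ∨ s = -1 ∨ s = 1 / 3 ∨ s = -1 / 3 := by
  by_contra hcon
  push Not at hcon
  obtain ⟨h0, h1, h2, h3, h4⟩ := hcon
  have hq : (s.den : ℚ) ≠ 0 := by exact_mod_cast s.den_ne_zero
  have hs : s * s.den = s.num := Rat.mul_den_eq_num s
  have hA : 1 - s ^ 2 ≠ 0 := by
    have : 1 - s ^ 2 = -((s - 1) * (s - -1)) := by ring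
    rw [this]
    exact neg_ne_zero.mpr (mul_ne_zero (sub_ne_zero.mpr h1) (sub_ne_zero.mpr h2))
  have hB : 1 - 9 * s ^ 2 ≠ 0 := by
    have : 1 - 9 * s ^ 2 = -9 * ((s - 1 / 3) * (s - -1 / 3)) := by ring
    rw [this]
    exact mul_ne_zero (by norm_num) (mul_ne_zero (sub_ne_zero.mpr h3) (sub_ne_zero.mpr h4))
  have eA : ((s.den : ℚ) ^ 2 - (s.num : ℚ) ^ 2) = s.den ^ 2 * (1 - s ^ 2) := by rw [← hs]; ring
  have eB : ((s.den : ℚ) ^ 2 - 9 * (s.num : ℚ) ^ 2) = s.den ^ 2 * (1 - 9 * s ^ 2) := by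
    rw [← hs]; ring
  have hsq : IsSquare ((((s.den : ℤ) ^ 2 - s.num ^ 2) * ((s.den : ℤ) ^ 2 - 9 * s.num ^ 2) : ℤ)) := by
    rw [← Rat.isSquare_intCast_iff]
    refine ⟨s.den ^ 2 * z, ?_⟩
    push_cast
    rw [eA, eB]
    linear_combination (-(s.den : ℚ) ^ 4) * h
  obtain ⟨w, hw⟩ := hsq
  refine Q24.main s.num s.den w ?_ (by simpa using h0) (by exact_mod_cast s.den_ne_zero) ?_ ?_
    (by rw [hw]; ring)
  · rw [Int.isCoprime_iff_gcd_eq_one]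
    simpa [Int.gcd] using s.reduced
  · intro hh
    have : ((s.den : ℚ) ^ 2 - (s.num : ℚ) ^ 2) = 0 := by exact_mod_cast hh
    rw [eA] at this
    exact mul_ne_zero (pow_ne_zero 2 hq) hA this
  · intro hh
    have : ((s.den : ℚ) ^ 2 - 9 * (s.num : ℚ) ^ 2) = 0 := by exact_mod_cast hh
    rw [eB] at this
    exact mul_ne_zero (pow_ne_zero 2 hq) hB this
end

section
/- If m, s ∈ ℚ satisfy s² = (1 + 9m²)(1 + 81m²), then m = 0 (and s = ±1). -/
theorem aux_odd_sq {x : ℤ} (hx : x % 2 = 1) : x ^ 2 % 8 = 1 := by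
  have h : x % 8 = 1 ∨ x % 8 = 3 ∨ x % 8 = 5 ∨ x % 8 = 7 := by omega
  rcases h with h | h | h | h <;> simp [pow_two, Int.mul_emod, h]

theorem aux_pyth {x y z : ℤ} (h : x ^ 2 + y ^ 2 = z ^ 2) (hc : IsCoprime x y)
    (hx : x % 2 = 1) (hz : 0 < z) :
    ∃ u v : ℤ, y = 2 * (u * v) ∧ z = u ^ 2 + v ^ 2 ∧ IsCoprime u v ∧ u % 2 = 0 ∧ v % 2 = 1 := by
  have hp : PythagoreanTriple x y z := by
    unfold PythagoreanTriple
    linarith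
  obtain ⟨m, n, -, h2, h3, h4, h5, -⟩ :=
    hp.coprime_classification' (Int.isCoprime_iff_gcd_eq_one.mp hc) hx hz
  have h4 := Int.isCoprime_iff_gcd_eq_one.mpr h4
  rcases h5 with h5 | h5
  · exact ⟨m, n, by linarith, h3, h4, h5.1, h5.2⟩
  · exact ⟨n, m, by linarith, by linarith, h4.symm, h5.2, h5.1⟩

theorem aux_core {u v w z : ℤ} (hu0 : u ≠ 0) (huv : IsCoprime u v) (hv : v % 2 = 1)
    (hwz : IsCoprime w z) (hz : z % 2 = 1) (hmul : w * z = u * v)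
    (hsq : u ^ 2 + v ^ 2 = 4 * w ^ 2 + z ^ 2) :
    ∃ a b c d : ℤ, a ∣ u ∧ b ^ 2 + 3 * a ^ 2 = c ^ 2 ∧ b ^ 2 + 4 * a ^ 2 = d ^ 2 := by
  obtain ⟨a, b, ⟨c, rfl⟩, ⟨d, rfl⟩, rfl⟩ :=
    exists_dvd_and_dvd_of_dvd_mul (Dvd.intro v hmul.symm : u ∣ w * z)
  have hv' : v = c * d := by
    apply mul_left_cancel₀ hu0
    linear_combination -hmul
  subst hv'
  have had : IsCoprime a d := (huv.of_mul_left_left).of_mul_right_right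
  have hbc : IsCoprime b c := (hwz.of_mul_left_right).of_mul_right_left.symm
  have ha0 : a ≠ 0 := left_ne_zero_of_mul hu0
  have hb := (Int.odd_mul.mp (Int.odd_iff.mpr hz)).1
  have hc := (Int.odd_mul.mp (Int.odd_iff.mpr hv)).1
  have hd := (Int.odd_mul.mp (Int.odd_iff.mpr hv)).2
  have hb2 := aux_odd_sq (Int.odd_iff.mp hb)
  have hc2 := aux_odd_sq (Int.odd_iff.mp hc)
  have hd2 := aux_odd_sq (Int.odd_iff.mp hd)
  have key : a ^ 2 * (b ^ 2 - 4 * c ^ 2) = d ^ 2 * (b ^ 2 - c ^ 2) := by linear_combination hsq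
  have hdvd : a ^ 2 ∣ b ^ 2 - c ^ 2 :=
    (had.pow (m := 2) (n := 2)).dvd_of_dvd_mul_left (Dvd.intro _ key)
  obtain ⟨e, he⟩ := hdvd
  have he2 : b ^ 2 - 4 * c ^ 2 = e * d ^ 2 := by
    apply mul_left_cancel₀ (pow_ne_zero 2 ha0)
    rw [key, he]; ring
  have he3 : e ∣ 3 := by
    obtain ⟨r, t, hrt⟩ := hbc.pow (m := 2) (n := 2)
    refine ⟨r * (4 * a ^ 2 - d ^ 2) + t * (a ^ 2 - d ^ 2), ?_⟩
    linear_combination (-3) * hrt + (4 * r + t) * he - (r + t) * he2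
  have he8 : e % 8 = 5 := by
    have : (e * d ^ 2) % 8 = e % 8 := by rw [Int.mul_emod, hd2]; omega
    omega
  have he4 : e ≤ 3 := Int.le_of_dvd (by norm_num) he3
  have he5 : -e ≤ 3 := Int.le_of_dvd (by norm_num) ((neg_dvd).mpr he3)
  have he6 : e = -3 := by omega
  subst he6
  exact ⟨a, b, c, d, Dvd.intro _ rfl, by linarith, by linarith⟩

theorem aux_main (n : ℕ) : ∀ k L N M : ℤ, k.natAbs = n → L ^ 2 + 3 * k ^ 2 = N ^ 2 →
    L ^ 2 + 4 * k ^ 2 = M ^ 2 → k = 0 := by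
  induction n using Nat.strong_induction_on with
  | _ n ih =>
  intro k L N M hn h1 h2
  by_contra hk
  by_cases hc : IsCoprime L k
  · -- coprime case: descent
    wlog hM : 0 < M generalizing M
    · rcases (not_lt.mp hM).lt_or_eq with h | h
      · exact this (-M) (by linarith [neg_sq M]) (by linarith)
      · subst h
        have : 0 < k ^ 2 := by positivity
        nlinarith [sq_nonneg L]
    have hpar : L % 2 = 1 ∧ k % 2 = 0 ∧ N % 2 = 1 := by
      have hL := Int.emod_emod_of_dvd L (show (2 : ℤ) ∣ 8 by norm_num)
      have sq8 : ∀ x : ℤ, (x % 2 = 1 ∧ x ^ 2 % 8 = 1) ∨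
          (x % 2 = 0 ∧ (x ^ 2 % 8 = 0 ∨ x ^ 2 % 8 = 4)) := by
        intro x
        rcases Int.emod_two_eq_zero_or_one x with h | h
        · right
          refine ⟨h, ?_⟩
          have h : x % 8 = 0 ∨ x % 8 = 2 ∨ x % 8 = 4 ∨ x % 8 = 6 := by omega
          rcases h with h | h | h | h <;> simp [pow_two, Int.mul_emod, h]
        · exact Or.inl ⟨h, aux_odd_sq h⟩
      have hnot : ¬ (L % 2 = 0 ∧ k % 2 = 0) := by
        rintro ⟨ha, hb⟩
        have := hc.isUnit_of_dvd' (Int.dvd_of_emod_eq_zero ha) (Int.dvd_of_emod_eq_zero hb)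
        rw [Int.isUnit_iff] at this
        omega
      have a1 := sq8 L
      have a2 := sq8 k
      have a3 := sq8 N
      have a4 := sq8 M
      omega
    obtain ⟨hL, hk2, hN⟩ := hpar
    have hLk2 : IsCoprime L (2 * k) := by
      refine IsCoprime.mul_right ?_ hc
      exact ⟨1, -(L / 2), by omega⟩
    have hNk : IsCoprime N k := by
      have : IsCoprime (N ^ 2) k := by
        have h3 : N ^ 2 = L ^ 2 + (3 * k) * k := by linear_combination -h1
        rw [h3]
        exact (hc.pow_left (m := 2)).add_mul_right_left (3 * k)
      exact (IsCoprime.pow_left_iff (by norm_num)).mp this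
    obtain ⟨u, v, e1, e2, e3, e4, e5⟩ := aux_pyth (x := N) (y := k) (z := M)
      (by linarith) hNk hN hM
    obtain ⟨w, z, f1, f2, f3, f4, f5⟩ := aux_pyth (x := L) (y := 2 * k) (z := M)
      (by linarith) hLk2 hL hM
    obtain ⟨w, rfl⟩ := Int.dvd_of_emod_eq_zero f4
    have hu0 : u ≠ 0 := by
      rintro rfl
      exact hk (by simpa using e1)
    have hv0 : v ≠ 0 := by
      rintro rfl
      exact hk (by simpa using e1)
    obtain ⟨a, b, c, d, g1, g2, g3⟩ := aux_core hu0 e3 e5 (f3.of_mul_left_right) f5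
      (by linarith) (by linarith)
    have ha0 : a ≠ 0 := by
      rintro rfl
      exact hu0 (zero_dvd_iff.mp g1)
    refine ha0 (ih a.natAbs ?_ a b c d rfl g2 g3)
    rw [← hn, e1, Int.natAbs_mul, Int.natAbs_mul]
    have i1 := Nat.le_of_dvd (Int.natAbs_pos.mpr hu0) (Int.natAbs_dvd_natAbs.mpr g1)
    have i2 := Int.natAbs_pos.mpr hv0
    have i3 := Int.natAbs_pos.mpr hu0
    have i4 := Nat.le_mul_of_pos_right u.natAbs i2
    simp only [Int.reduceAbs]
    omega
  · -- remove the common factor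
    have hg : Int.gcd L k ≠ 1 := fun h => hc (Int.isCoprime_iff_gcd_eq_one.mpr h)
    have hg0 : Int.gcd L k ≠ 0 := fun h => hk (Int.gcd_eq_zero_iff.mp h).2
    obtain ⟨L', hL'⟩ := Int.gcd_dvd_left L k
    obtain ⟨k', hk'⟩ := Int.gcd_dvd_right L k
    generalize Int.gcd L k = g at *
    subst hL' hk'
    have hgz : (g : ℤ) ≠ 0 := by exact_mod_cast hg0
    have hN : (g : ℤ) ∣ N := by
      rw [← Int.pow_dvd_pow_iff (n := 2) (by norm_num), ← h1]
      exact ⟨L' ^ 2 + 3 * k' ^ 2, by ring⟩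
    have hM : (g : ℤ) ∣ M := by
      rw [← Int.pow_dvd_pow_iff (n := 2) (by norm_num), ← h2]
      exact ⟨L' ^ 2 + 4 * k' ^ 2, by ring⟩
    obtain ⟨N', rfl⟩ := hN
    obtain ⟨M', rfl⟩ := hM
    have hk0 : k' ≠ 0 := right_ne_zero_of_mul hk
    refine hk0 (ih k'.natAbs ?_ k' L' N' M' rfl ?_ ?_)
    · rw [← hn, Int.natAbs_mul, Int.natAbs_natCast]
      have := Int.natAbs_pos.mpr hk0
      have : 2 ≤ g := by omega
      nlinarith
    · apply mul_left_cancel₀ (pow_ne_zero 2 hgz)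
      linear_combination h1
    · apply mul_left_cancel₀ (pow_ne_zero 2 hgz)
      linear_combination h2

/-- If `s² = (1 + 9m²)(1 + 81m²)` for rationals `m, s`, then `m = 0`. -/
theorem rational_points_quartic_48a1 (m s : ℚ)
    (h : s ^ 2 = (1 + 9 * m ^ 2) * (1 + 81 * m ^ 2)) :
    m = 0 := by
  have hq : (m.den : ℚ) ≠ 0 := by exact_mod_cast m.den_nz
  have hm : m = m.num / m.den := (Rat.num_div_den m).symm
  generalize m.num = p at *
  generalize m.den = q at *
  have hs : (s * q ^ 2) ^ 2 = (((q ^ 2 + 9 * p ^ 2) * (q ^ 2 + 81 * p ^ 2) : ℤ) : ℚ) := by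
    rw [mul_pow, h, hm]
    push_cast
    field_simp
  have hsq : IsSquare ((q ^ 2 + 9 * p ^ 2) * (q ^ 2 + 81 * p ^ 2) : ℤ) := by
    rw [← Rat.isSquare_intCast_iff]
    exact ⟨s * q ^ 2, by rw [← hs]; ring⟩
  obtain ⟨t, ht⟩ := hsq
  have := aux_main _ (6 * p * q) (q ^ 2 - 27 * p ^ 2) (q ^ 2 + 27 * p ^ 2) t rfl (by ring)
    (by linear_combination ht)
  have hq' : (q : ℤ) ≠ 0 := by exact_mod_cast hq
  have hp : p = 0 := by
    rcases mul_eq_zero.mp this with h | h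
    · omega
    · exact absurd h hq'
  rw [hm, hp]
  simp
end
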